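/- Let B be a C*-algebra, let p and q be idempotents in B, and let b and b′ be invertible morphisms from p to q, with c′ the inverse of b′. Suppose there is a continuous path (b_t), t ∈ [0,1], of invertible morphisms from p to q with b₀ = b and b₁ = b′. Then the matrix [[0, −c′],[b, 0]] in M₂(B) is an invertible morphism from diag(p,q) to diag(p,q) and is joined to diag(p,q) by a continuous path of invertible morphisms from diag(p,q) to diag(p,q). -/

import Mathlib

/-- `b` is a morphism from the idempotent `p` to the idempotent `q`,
i.e. `b = q * b * p`. -/
def IsMor {R : Type*} [Mul R] (p q b : R) : Prop := b = q * b * p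

/-- `b` is an invertible morphism from the idempotent `p` to the idempotent `q`:
it is a morphism from `p` to `q` and there is a morphism `c` from `q` to `p` with
`c * b = p` and `b * c = q`. -/
def IsInvMor {R : Type*} [Mul R] (p q b : R) : Prop :=
  IsMor p q b ∧ ∃ c, IsMor q p c ∧ c * b = p ∧ b * c = q

/-- The 2×2 diagonal matrix `diag(x, y)`. -/
def mdiag {R : Type*} [Zero R] (x y : R) : Matrix (Fin 2) (Fin 2) R := !![x, 0; 0, y]

theorem IsMor.left_mul {R : Type*} [Semigroup R] {p q b : R} (hq : q * q = q)
    (h : IsMor p q b) : q * b = b := by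
  unfold IsMor at h
  rw [h, ← mul_assoc, ← mul_assoc, hq]

theorem IsMor.mul_right {R : Type*} [Semigroup R] {p q b : R} (hp : p * p = p)
    (h : IsMor p q b) : b * p = b := by
  unfold IsMor at h
  rw [h, mul_assoc, hp]

theorem isMor_mdiag {R : Type*} [NonUnitalSemiring R] {p q x y z w : R}
    (hx : IsMor p p x) (hy : IsMor q p y) (hz : IsMor p q z) (hw : IsMor q q w) :
    IsMor (mdiag p q) (mdiag p q) !![x, y; z, w] := by
  unfold IsMor at *
  simp only [mdiag, Matrix.mul_fin_two, mul_zero, zero_mul, add_zero, zero_add,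
    ← hx, ← hy, ← hz, ← hw]

theorem IsMor.smul {S R : Type*} [Mul R] [SMul S R] [IsScalarTower S R R]
    [SMulCommClass S R R] {p q b : R} (r : S) (h : IsMor p q b) : IsMor p q (r • b) := by
  unfold IsMor at *
  rw [mul_smul_comm, smul_mul_assoc, ← h]

theorem IsMor.neg {R : Type*} [NonUnitalRing R] {p q b : R} (h : IsMor p q b) :
    IsMor p q (-b) := by
  unfold IsMor at *
  rw [mul_neg, neg_mul, ← h]

theorem isMor_zero {R : Type*} [NonUnitalSemiring R] (p q : R) : IsMor p q 0 := by
  simp [IsMor]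

theorem isMor_self {R : Type*} [Mul R] {p : R} (hp : p * p = p) : IsMor p p p := by
  simp [IsMor, hp]

/-- The antidiagonal matrix built from an invertible morphism and an inverse of another one. -/
theorem isInvMor_antidiag {R : Type*} [NonUnitalRing R] {p q b c : R}
    (hb : IsInvMor p q b) (hc : IsInvMor q p c) :
    IsInvMor (mdiag p q) (mdiag p q) !![0, -c; b, 0] := by
  obtain ⟨hbm, d, hdm, hdb, hbd⟩ := hb
  obtain ⟨hcm, e, hem, hec, hce⟩ := hc
  refine ⟨isMor_mdiag (isMor_zero p p) hcm.neg hbm (isMor_zero q q), !![0, d; -e, 0],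
    isMor_mdiag (isMor_zero p p) hdm hem.neg (isMor_zero q q), ?_, ?_⟩ <;>
  simp [mdiag, hdb, hbd, hec, hce]

/-- The rotation built from a morphism `b` and its inverse `c`. -/
theorem isInvMor_rotation {S R : Type*} [CommRing S] [NonUnitalRing R] [Module S R]
    [IsScalarTower S R R] [SMulCommClass S R R] {p q b c : R}
    (hp : p * p = p) (hq : q * q = q) (hb : IsMor p q b) (hc : IsMor q p c)
    (hcb : c * b = p) (hbc : b * c = q) {x y : S} (hxy : x * x + y * y = 1) :
    IsInvMor (mdiag p q) (mdiag p q) !![x • p, -(y • c); y • b, x • q] := by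
  refine ⟨isMor_mdiag ((isMor_self hp).smul x) (hc.smul y).neg (hb.smul y)
      ((isMor_self hq).smul x), !![x • p, y • c; -(y • b), x • q],
    isMor_mdiag ((isMor_self hp).smul x) (hc.smul y) (hb.smul y).neg
      ((isMor_self hq).smul x), ?_, ?_⟩
  all_goals
    have hyx : y * y + x * x = 1 := by rw [add_comm, hxy]
    simp [mdiag, mul_smul_comm, smul_mul_assoc, smul_smul, hp, hq, hcb, hbc, hb.left_mul hq,
      hb.mul_right hp, hc.left_mul hp, hc.mul_right hq, ← add_smul, hxy, hyx, mul_comm y x]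

/-- Let `p`, `q` be idempotents in a C*-algebra `B`, let `b` and `b'` be invertible
morphisms from `p` to `q`, with `c'` the inverse of `b'`, and suppose there is a
continuous path `(b_t)`, `t ∈ [0,1]`, of invertible morphisms from `p` to `q` with
`b₀ = b` and `b₁ = b'`.  Then `[[0, -c'], [b, 0]]` is an invertible morphism from
`diag(p,q)` to `diag(p,q)` and is joined to `diag(p,q)` by a continuous path of
invertible morphisms from `diag(p,q)` to `diag(p,q)`. -/
theorem statement1 {B : Type*} [NonUnitalCStarAlgebra B] (p q b b' c' : B)
    (hp : p * p = p) (hq : q * q = q)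
    (hb : IsInvMor p q b)
    (hb'm : IsMor p q b') (hc'm : IsMor q p c') (hcb' : c' * b' = p) (hbc' : b' * c' = q)
    (f : ℝ → B) (hf : ContinuousOn f (Set.Icc 0 1))
    (hf0 : f 0 = b) (hf1 : f 1 = b')
    (hfm : ∀ t ∈ Set.Icc (0 : ℝ) 1, IsInvMor p q (f t)) :
    IsInvMor (mdiag p q) (mdiag p q) !![(0 : B), -c'; b, 0] ∧
    ∃ g : ℝ → Matrix (Fin 2) (Fin 2) B,
      ContinuousOn g (Set.Icc 0 1) ∧
      g 0 = mdiag p q ∧ g 1 = !![(0 : B), -c'; b, 0] ∧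
      ∀ t ∈ Set.Icc (0 : ℝ) 1, IsInvMor (mdiag p q) (mdiag p q) (g t) := by
  have hc' : IsInvMor q p c' := ⟨hc'm, b', hb'm, hbc', hcb'⟩
  refine ⟨isInvMor_antidiag hb hc', fun t =>
    let θ : ℝ := min (Real.pi * t) (Real.pi / 2)
    !![(Real.cos θ : ℂ) • p, -((Real.sin θ : ℂ) • c');
      (Real.sin θ : ℂ) • f (min 1 (2 - 2 * t)), (Real.cos θ : ℂ) • q], ?_, ?_, ?_, ?_⟩
  · have hs : ContinuousOn (fun t : ℝ => f (min 1 (2 - 2 * t))) (Set.Icc 0 1) := by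
      refine hf.comp (by fun_prop) fun t ht => ⟨le_min zero_le_one ?_, min_le_left _ _⟩
      linarith [ht.2]
    refine continuousOn_pi.2 fun i => continuousOn_pi.2 fun j => ?_
    fin_cases i <;> fin_cases j <;> simp
    · fun_prop
    · fun_prop
    · exact ContinuousOn.smul (by fun_prop) hs
    · fun_prop
  · have h : min 0 (Real.pi / 2) = 0 := min_eq_left (by positivity)
    simp [h, mdiag]
  · have h : min Real.pi (Real.pi / 2) = Real.pi / 2 := min_eq_right (by linarith [Real.pi_pos])
    simp [h, hf0, -Complex.ofReal_cos, -Complex.ofReal_sin]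
  · intro t ht
    rcases le_total t (1 / 2) with h | h
    · have hs : min 1 (2 - 2 * t) = 1 := min_eq_left (by linarith)
      simp only [hs, hf1]
      refine isInvMor_rotation hp hq hb'm hc'm hcb' hbc' ?_
      norm_cast
      rw [← sq, ← sq, Real.cos_sq_add_sin_sq]
    · have hs : min 1 (2 - 2 * t) = 2 - 2 * t := min_eq_right (by linarith)
      have hθ : min (Real.pi * t) (Real.pi / 2) = Real.pi / 2 :=
        min_eq_right (by nlinarith [Real.pi_pos])
      simp only [hs, hθ, Real.cos_pi_div_two, Real.sin_pi_div_two, Complex.ofReal_zero,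
        Complex.ofReal_one, zero_smul, one_smul]
      exact isInvMor_antidiag (hfm _ ⟨by linarith [ht.2], by linarith⟩) hc'
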